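/- Let B and C be disjoint finite linearly independent sets of nonzero vectors of V, and let D ⊆ B ∪ C be a nonempty subset with |D| ≥ 2·dim(span D). Then D ∩ B and D ∩ C are both bases of span(D); in particular both are nonempty and every element of D ∩ B lies in span(D ∩ C). -/

import Mathlib

/-!
**Statement 12.** Let `B` and `C` be disjoint finite linearly independent sets of
nonzero vectors of `V`, and let `D ⊆ B ∪ C` be a nonempty subset with
`|D| ≥ 2 · dim (span D)`.  Then `D ∩ B` and `D ∩ C` are both bases of `span D`;
in particular both are nonempty and every element of `D ∩ B` lies in
`span (D ∩ C)`.
-/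

open Module Submodule

variable {V : Type*} [AddCommGroup V] [Module ℂ V]

/-- A finite set of vectors is linearly independent. -/
def LinIndepF (T : Finset V) : Prop :=
  LinearIndependent ℂ (fun v : {x : V // x ∈ T} => (v : V))

theorem LinIndepF.mono {S T : Finset V} (hT : LinIndepF T) (h : S ⊆ T) : LinIndepF S :=
  LinearIndepOn.mono (v := id) (s := (T : Set V)) (t := (S : Set V)) hT (Finset.coe_subset.2 h)

theorem LinIndepF.finrank_span {T : Finset V} (hT : LinIndepF T) :
    finrank ℂ (span ℂ (T : Set V)) = T.card :=
  finrank_span_finset_eq_card hT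

theorem LinIndepF.card_le_finrank_span [FiniteDimensional ℂ V] {S D : Finset V}
    (hS : LinIndepF S) (h : S ⊆ D) : S.card ≤ finrank ℂ (span ℂ (D : Set V)) :=
  hS.finrank_span ▸ finrank_mono (span_mono (Finset.coe_subset.2 h))

theorem LinIndepF.span_eq_of_finrank_le_card [FiniteDimensional ℂ V] {S D : Finset V}
    (hS : LinIndepF S) (h : S ⊆ D) (hcard : finrank ℂ (span ℂ (D : Set V)) ≤ S.card) :
    span ℂ (S : Set V) = span ℂ (D : Set V) :=
  eq_of_le_of_finrank_le (span_mono (Finset.coe_subset.2 h)) (hS.finrank_span.symm ▸ hcard)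

/-- A finset with the same span as one containing a nonzero vector is nonempty. -/
theorem nonempty_of_span_eq_of_mem {S D : Finset V} {d : V} (hd : d ∈ D) (hd0 : d ≠ 0)
    (h : span ℂ (S : Set V) = span ℂ (D : Set V)) : S.Nonempty := by
  rw [Finset.nonempty_iff_ne_empty]
  rintro rfl
  have hmem : d ∈ span ℂ (D : Set V) := subset_span hd
  rw [← h] at hmem
  simp [hd0] at hmem

theorem inter_bases_of_card_ge_two_mul_rank [DecidableEq V] [FiniteDimensional ℂ V]
    (B C : Finset V) (h0 : (0 : V) ∉ B ∪ C) (hBC : Disjoint B C)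
    (hB : LinIndepF B) (hC : LinIndepF C)
    (D : Finset V) (hD : D ⊆ B ∪ C) (hDne : D.Nonempty)
    (hcard : 2 * finrank ℂ (span ℂ (D : Set V)) ≤ D.card) :
    LinIndepF (D ∩ B) ∧ span ℂ ((D ∩ B : Finset V) : Set V) = span ℂ (D : Set V) ∧
      LinIndepF (D ∩ C) ∧ span ℂ ((D ∩ C : Finset V) : Set V) = span ℂ (D : Set V) ∧
      (D ∩ B).Nonempty ∧ (D ∩ C).Nonempty ∧
      ∀ b ∈ D ∩ B, b ∈ span ℂ ((D ∩ C : Finset V) : Set V) := by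
  have hDB : LinIndepF (D ∩ B) := hB.mono Finset.inter_subset_right
  have hDC : LinIndepF (D ∩ C) := hC.mono Finset.inter_subset_right
  have hsum : (D ∩ B).card + (D ∩ C).card = D.card := by
    rw [← Finset.card_union_of_disjoint
      (hBC.mono Finset.inter_subset_right Finset.inter_subset_right),
      ← Finset.inter_union_distrib_left, Finset.inter_eq_left.2 hD]
  have hBle := hDB.card_le_finrank_span (D := D) Finset.inter_subset_left
  have hCle := hDC.card_le_finrank_span (D := D) Finset.inter_subset_left
  have hBspan := hDB.span_eq_of_finrank_le_card (D := D) Finset.inter_subset_left (by omega)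
  have hCspan := hDC.span_eq_of_finrank_le_card (D := D) Finset.inter_subset_left (by omega)
  obtain ⟨d, hd⟩ := hDne
  have hd0 : d ≠ 0 := fun h => h0 (h ▸ hD hd)
  refine ⟨hDB, hBspan, hDC, hCspan, nonempty_of_span_eq_of_mem hd hd0 hBspan,
    nonempty_of_span_eq_of_mem hd hd0 hCspan, fun b hb => ?_⟩
  rw [hCspan]
  exact subset_span (Finset.mem_of_mem_inter_left hb)
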